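/- Fix integers $s \ge 2$, $d \ge 0$, and a tuple $\mathbf{n} = (n_0,\dots,n_{s-1})$ of nonnegative integers with $\sum_i n_i = n$. Let $P : \mathbb{Z}_s^n \to G$ be a $d$-junta-sum that is nonzero at some point of the multislice $\mathcal{S}^n_{\mathbf{n}}$ (the set of $\mathbf{a} \in \mathbb{Z}_s^n$ in which each symbol $i$ appears exactly $n_i$ times). Then the number of points $\mathbf{a} \in \mathcal{S}^n_{\mathbf{n}}$ with $P(\mathbf{a}) \ne 0$ is at least $\binom{n - sd}{n_0 - d, n_1 - d, \dots, n_{s-1} - d}$ (interpreted as 0 if any entry is negative). -/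

import Mathlib

open Finset

/-- `f` depends only on the coordinates in `I`. -/
def DependsOnlyOn {n : ℕ} {A G : Type*} (f : (Fin n → A) → G) (I : Finset (Fin n)) : Prop :=
  ∀ x y : Fin n → A, (∀ i ∈ I, x i = y i) → f x = f y

/-- `f` is a sum of functions each depending on at most `d` coordinates
(a `d`-junta-sum). -/
def IsJuntaSum {n : ℕ} {A G : Type*} [AddCommMonoid G] (d : ℕ)
    (f : (Fin n → A) → G) : Prop :=
  ∃ (k : ℕ) (g : Fin k → (Fin n → A) → G) (I : Fin k → Finset (Fin n)),
    (∀ j, (I j).card ≤ d ∧ DependsOnlyOn (g j) (I j)) ∧ ∀ x, f x = ∑ j, g j x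

namespace MS

def cnt {ι A : Type*} [Fintype ι] [DecidableEq A] (a : ι → A) (c : A) : ℕ :=
  ∑ k, if a k = c then 1 else 0

def Gen (ι A G : Type*) (d : ℕ) : Set ((ι → A) → G) :=
  {f | ∃ I : Finset ι, I.card ≤ d ∧ ∀ x y : ι → A, (∀ i ∈ I, x i = y i) → f x = f y}

def JS (ι A G : Type*) [AddCommGroup G] (d : ℕ) : AddSubgroup ((ι → A) → G) :=
  AddSubgroup.closure (Gen ι A G d)

def ext {ι A : Type*} [DecidableEq ι] (i j : ι) (y : {k : ι // k ≠ i ∧ k ≠ j} → A) (u v : A) :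
    ι → A :=
  fun k => if h : k ≠ i ∧ k ≠ j then y ⟨k, h⟩ else if k = i then u else v

theorem multinomial_mono {A : Type*} [DecidableEq A] (s : Finset A) (f g : A → ℕ)
    (h : ∀ c, f c ≤ g c) : Nat.multinomial s f ≤ Nat.multinomial s g := by
  induction s using Finset.induction_on with
  | empty => simp
  | insert a s ha ih =>
    rw [Nat.multinomial_insert ha, Nat.multinomial_insert ha]
    apply Nat.mul_le_mul _ ih
    have hs : ∑ i ∈ s, f i ≤ ∑ i ∈ s, g i := Finset.sum_le_sum fun i _ => h i
    calc (f a + ∑ i ∈ s, f i).choose (f a) ≤ (f a + ∑ i ∈ s, g i).choose (f a) :=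
          Nat.choose_le_choose _ (by omega)
      _ = (f a + ∑ i ∈ s, g i).choose (∑ i ∈ s, g i) := Nat.choose_symm_add
      _ ≤ (g a + ∑ i ∈ s, g i).choose (∑ i ∈ s, g i) :=
          Nat.choose_le_choose _ (by have := h a; omega)
      _ = _ := Nat.choose_symm_add.symm

theorem cnt_perm {ι A : Type*} [Fintype ι] [DecidableEq A] (a : ι → A) (σ : Equiv.Perm ι) (c : A) :
    cnt (fun k => a (σ k)) c = cnt a c :=
  Equiv.sum_comp σ (fun k => if a k = c then 1 else 0)

theorem cnt_eq_card {ι A : Type*} [Fintype ι] [DecidableEq A] (a : ι → A) (c : A) :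
    cnt a c = Fintype.card {k // a k = c} := by
  simp [cnt, Fintype.card_subtype]

theorem sum_cnt {ι A : Type*} [Fintype ι] [Fintype A] [DecidableEq A] (a : ι → A) :
    ∑ c, cnt a c = Fintype.card ι := by
  unfold cnt
  rw [Finset.sum_comm]
  simp

theorem cnt_ext {ι A : Type*} [Fintype ι] [DecidableEq ι] [DecidableEq A] {i j : ι} (hij : i ≠ j)
    (y : {k : ι // k ≠ i ∧ k ≠ j} → A) (u v c : A) :
    cnt (ext i j y u v) c = cnt y c + (if u = c then 1 else 0) + (if v = c then 1 else 0) := by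
  unfold cnt
  rw [← Fintype.sum_subtype_add_sum_subtype (fun k : ι => k ≠ i ∧ k ≠ j), add_assoc]
  congr 1
  · apply Finset.sum_congr rfl
    rintro ⟨k, hk⟩ _
    simp [ext, hk]
  · have h1 : ∑ k : {k : ι // ¬ (k ≠ i ∧ k ≠ j)}, (if ext i j y u v k = c then 1 else 0)
      = ∑ k ∈ ({i, j} : Finset ι), (if ext i j y u v k = c then 1 else 0) := by
      symm
      apply Finset.sum_subtype
      intro x
      simp only [Finset.mem_insert, Finset.mem_singleton]
      tauto
    rw [h1, Finset.sum_pair hij]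
    simp [ext, hij.symm]

theorem orbit_card {ι A : Type*} [Fintype ι] [DecidableEq ι] [Fintype A] [DecidableEq A]
    (a : ι → A) (T : Finset (ι → A)) (hT : ∀ σ : Equiv.Perm ι, (fun k => a (σ k)) ∈ T) :
    Nat.multinomial Finset.univ (cnt a) ≤ T.card := by
  classical
  have hstab := DomMulAct.stabilizer_card (f := a)
  simp only [← cnt_eq_card a] at hstab
  have h1 : (Finset.univ : Finset (Equiv.Perm ι)).card ≤ (∏ c, (cnt a c).factorial) * T.card := by
    apply Finset.card_le_mul_card_image_of_maps_to (f := fun σ : Equiv.Perm ι => fun k => a (σ k))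
    · intro σ _
      exact hT σ
    · intro b _
      rw [← hstab, Fintype.card_subtype]
      rcases Finset.eq_empty_or_nonempty
        (Finset.univ.filter fun σ : Equiv.Perm ι => (fun k => a (σ k)) = b) with h | ⟨τ, hτ⟩
      · rw [h]; simp
      · simp only [Finset.mem_filter, Finset.mem_univ, true_and] at hτ
        apply Finset.card_le_card_of_injOn (fun σ => σ * τ⁻¹)
        · intro σ hσ
          simp only [Finset.coe_filter, Finset.mem_univ, true_and, Set.mem_ofPred_eq] at hσ ⊢
          funext k
          have e := congrFun (hσ.trans hτ.symm) (τ⁻¹ k)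
          simpa using e
        · intro σ _ σ' _ h
          exact mul_right_cancel h
  rw [Finset.card_univ, Fintype.card_perm, ← sum_cnt a, ← Nat.multinomial_spec] at h1
  exact Nat.le_of_mul_le_mul_left h1 (Finset.prod_pos fun c _ => Nat.factorial_pos _)

theorem diff_mem {ι A G : Type*} [Fintype ι] [DecidableEq ι] [AddCommGroup G] (d : ℕ)
    (P : (ι → A) → G) (hP : P ∈ JS ι A G (d + 1)) (i j : ι) (hij : i ≠ j) (u v : A) :
    (fun y => P (ext i j y u v) - P (ext i j y v u)) ∈ JS {k : ι // k ≠ i ∧ k ≠ j} A G d := by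
  induction hP using AddSubgroup.closure_induction with
  | mem f hf =>
    obtain ⟨I, hI, hf⟩ := hf
    by_cases h : i ∈ I ∨ j ∈ I
    · apply AddSubgroup.subset_closure
      refine ⟨I.subtype _, ?_, ?_⟩
      · rw [Finset.card_subtype]
        have : (I.filter fun k => k ≠ i ∧ k ≠ j).card < I.card := by
          apply Finset.card_lt_card
          rw [Finset.filter_ssubset]
          rcases h with h | h
          · exact ⟨i, h, by simp⟩
          · exact ⟨j, h, by simp⟩
        omega
      · intro x y hxy
        have key : ∀ u v, f (ext i j x u v) = f (ext i j y u v) := by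
          intro u v
          apply hf
          intro k hk
          unfold ext
          split_ifs with h1
          · exact hxy ⟨k, h1⟩ (by simpa using hk)
          · rfl
          · rfl
        simp only [key]
    · have : (fun y => f (ext i j y u v) - f (ext i j y v u)) = 0 := by
        funext y
        simp only [Pi.zero_apply, sub_eq_zero]
        apply hf
        intro k hk
        have : k ≠ i ∧ k ≠ j := by
          constructor
          · rintro rfl; exact h (Or.inl hk)
          · rintro rfl; exact h (Or.inr hk)
        simp [ext, this]
      rw [this]
      exact zero_mem _
  | zero =>
    convert zero_mem (JS {k : ι // k ≠ i ∧ k ≠ j} A G d) using 1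
    funext y
    simp
  | add f g _ _ hf hg =>
    convert add_mem hf hg using 1
    funext y
    simp only [Pi.add_apply]
    abel
  | neg f _ hf =>
    convert neg_mem hf using 1
    funext y
    simp only [Pi.neg_apply]
    abel

theorem const_case {ι A G : Type*} [Fintype ι] [DecidableEq ι] [Fintype A] [DecidableEq A]
    [AddCommGroup G] [DecidableEq G] (d : ℕ) (P : (ι → A) → G) (a₀ : ι → A) (h0 : P a₀ ≠ 0)
    (h : ∀ (a : ι → A) (i j : ι), (∀ c, cnt a c = cnt a₀ c) →
      P (fun k => a (Equiv.swap i j k)) = P a) :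
    Nat.multinomial Finset.univ (fun c => cnt a₀ c - d) ≤
      (Finset.univ.filter fun a : ι → A => (∀ c, cnt a c = cnt a₀ c) ∧ P a ≠ 0).card := by
  refine (multinomial_mono _ _ (cnt a₀) fun c => Nat.sub_le _ _).trans ?_
  apply orbit_card
  intro σ
  simp only [Finset.mem_filter, Finset.mem_univ, true_and]
  refine ⟨fun c => cnt_perm _ _ _, ?_⟩
  suffices P (fun k => a₀ (σ k)) = P a₀ by rwa [this]
  induction σ using Equiv.Perm.swap_induction_on' with
  | one => rfl
  | mul_swap f x y hxy ih =>
    rw [← ih]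
    exact h (fun k => a₀ (f k)) x y (fun c => cnt_perm _ _ _)

theorem main {A G : Type*} [Fintype A] [DecidableEq A] [AddCommGroup G] [DecidableEq G] (d : ℕ) :
    ∀ (ι : Type) [Fintype ι] [DecidableEq ι] (P : (ι → A) → G), P ∈ JS ι A G d →
    ∀ (a₀ : ι → A), P a₀ ≠ 0 → (∀ c, d ≤ cnt a₀ c) →
    Nat.multinomial Finset.univ (fun c => cnt a₀ c - d) ≤
      (Finset.univ.filter fun a : ι → A => (∀ c, cnt a c = cnt a₀ c) ∧ P a ≠ 0).card := by
  induction d with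
  | zero =>
    intro ι _ _ P hP a₀ h0 _
    apply const_case 0 P a₀ h0
    intro a i j _
    have : ∀ x y, P x = P y := by
      intro x y
      clear h0
      induction hP using AddSubgroup.closure_induction with
      | mem f hf =>
        obtain ⟨I, hI, hf⟩ := hf
        apply hf
        have : I = ∅ := by simpa using hI
        simp [this]
      | zero => rfl
      | add f g _ _ hf hg => simp only [Pi.add_apply, hf, hg]
      | neg f _ hf => simp only [Pi.neg_apply, hf]
    exact this _ _
  | succ d IH =>
    intro ι _ _ P hP a₀ h0 hd
    by_cases h : ∀ (a : ι → A) (i j : ι), (∀ c, cnt a c = cnt a₀ c) →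
      P (fun k => a (Equiv.swap i j k)) = P a
    · exact const_case (d + 1) P a₀ h0 h
    push Not at h
    obtain ⟨a, i, j, hc, hne⟩ := h
    have hij : i ≠ j := by
      rintro rfl
      simp at hne
    have huv : a i ≠ a j := by
      intro huv
      apply hne
      congr 1
      funext k
      rcases eq_or_ne k i with rfl | hi
      · simp [huv]
      rcases eq_or_ne k j with rfl | hj
      · simp [huv]
      rw [Equiv.swap_apply_of_ne_of_ne hi hj]
    let y₀ : {k : ι // k ≠ i ∧ k ≠ j} → A := fun k => a k
    have e1 : ext i j y₀ (a i) (a j) = a := by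
      funext k
      unfold ext
      split_ifs with h1 h2
      · rfl
      · rw [h2]
      · have : k = j := by tauto
        rw [this]
    have e2 : ext i j y₀ (a j) (a i) = fun k => a (Equiv.swap i j k) := by
      funext k
      unfold ext
      split_ifs with h1 h2
      · rw [Equiv.swap_apply_of_ne_of_ne h1.1 h1.2]
      · simp [h2]
      · have : k = j := by tauto
        simp [this]
    have hcy : ∀ c, cnt a₀ c
        = cnt y₀ c + (if a i = c then 1 else 0) + (if a j = c then 1 else 0) := by
      intro c
      rw [← hc c, ← cnt_ext hij, e1]
    have hy : ∀ c, cnt a₀ c ≤ cnt y₀ c + 1 := by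
      intro c
      rw [hcy c]
      split_ifs with h1 h2
      · exact absurd (h1.trans h2.symm) huv
      all_goals omega
    have key := IH {k : ι // k ≠ i ∧ k ≠ j} _ (diff_mem d P hP i j hij (a i) (a j)) y₀
      (by simp only [e1, e2]; exact sub_ne_zero.mpr hne.symm)
      (by intro c; have := hd c; have := hy c; omega)
    refine (multinomial_mono _ _ _ ?_).trans (key.trans ?_)
    · intro c; have := hy c; show _ - _ ≤ _ - _; omega
    apply Finset.card_le_card_of_injOn
      (fun y => if P (ext i j y (a i) (a j)) ≠ 0 then ext i j y (a i) (a j)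
        else ext i j y (a j) (a i))
    · intro y hy
      simp only [Finset.coe_filter, Finset.mem_univ, true_and, Set.mem_ofPred_eq] at hy ⊢
      obtain ⟨hy1, hy2⟩ := hy
      split_ifs with h1
      · refine ⟨fun c => ?_, h1⟩
        rw [cnt_ext hij, hy1, hcy]
      · refine ⟨fun c => ?_, fun h2 => hy2 ?_⟩
        · rw [cnt_ext hij, hy1, hcy]; omega
        · rw [not_not.mp h1, h2, sub_zero]
    · have r : ∀ (y : {k : ι // k ≠ i ∧ k ≠ j} → A) (k : {k : ι // k ≠ i ∧ k ≠ j}),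
        (if P (ext i j y (a i) (a j)) ≠ 0 then ext i j y (a i) (a j)
          else ext i j y (a j) (a i)) k.1 = y k := by
        intro y k
        split_ifs <;> simp [ext, k.2]
      intro y _ y' _ hyy
      funext k
      have := congrFun hyy k.1
      simp only at this
      rwa [r, r] at this

end MS

/-- Sub-optimal distance lemma on multislices: if a `d`-junta-sum
`P : ℤ_s^n → G` is nonzero at some point of the multislice `S^n_𝐧`
(strings where each symbol `i` appears exactly `nvec i` times), then
the number of points of the multislice where `P` is nonzero is at least
the multinomial coefficient `(n - sd choose n₀ - d, …, n_{s-1} - d)`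
(interpreted as `0` if some entry is negative). -/
theorem stmt3 {s n d : ℕ} (hs : 2 ≤ s) [NeZero s] (nvec : ZMod s → ℕ)
    (hn : ∑ i, nvec i = n) {G : Type*} [AddCommGroup G]
    (P : (Fin n → ZMod s) → G) (hP : IsJuntaSum d P)
    (a₀ : Fin n → ZMod s)
    (ha₀ : ∀ i : ZMod s, {j : Fin n | a₀ j = i}.ncard = nvec i)
    (hP0 : P a₀ ≠ 0) :
    (if ∀ i : ZMod s, d ≤ nvec i then
        Nat.multinomial Finset.univ (fun i : ZMod s => nvec i - d) else 0)
      ≤ {a : Fin n → ZMod s |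
          (∀ i : ZMod s, {j : Fin n | a j = i}.ncard = nvec i) ∧ P a ≠ 0}.ncard := by
  classical
  split_ifs with hd
  swap
  · exact Nat.zero_le _
  have hcnt : ∀ (a : Fin n → ZMod s) (c : ZMod s), {j : Fin n | a j = c}.ncard = MS.cnt a c := by
    intro a c
    rw [Set.ncard_eq_toFinset_card', MS.cnt, Finset.sum_boole]
    simp
  simp only [hcnt] at ha₀ ⊢
  have hJ : P ∈ MS.JS (Fin n) (ZMod s) G d := by
    obtain ⟨k, g, I, hg, hP⟩ := hP
    have : P = ∑ j, g j := by
      funext x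
      rw [hP, Finset.sum_apply]
    rw [this]
    exact sum_mem fun j _ => AddSubgroup.subset_closure ⟨I j, (hg j).1, (hg j).2⟩
  have := MS.main d (Fin n) P hJ a₀ hP0 (fun c => by rw [ha₀]; exact hd c)
  simp only [ha₀] at this
  rw [Set.ncard_eq_toFinset_card']
  convert this using 2
  ext a
  simp
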